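/- Assume L̄|[0,+∞) is proper and L̄(t) < +∞ for some t > 0. Let (t_i) be a sequence of positive real numbers converging to 0. Then lim_i L̄*(L̄'_r(t_i)) = −L̄(0⁺) ∈ [0, +∞), where L̄(0⁺) = lim_{t→0⁺} L̄(t). If moreover L̄'_r(0⁺) > −∞, then lim_i L̄*(L̄'_r(t_i)) = L̄*(L̄'_r(0⁺)) = sup_{t>0} ( t·L̄'_r(0⁺) − L̄(t) ). -/

import Mathlib

open Filter MeasureTheory Set Topology

noncomputable section

/-- `c · log m` as an extended real number, where `m ∈ [0,∞]`. -/
def elog (c : ℝ) (m : ENNReal) : EReal := (c : EReal) * ENNReal.log m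

/-- The generalized log-moment generating function `L̄` associated with the net
`(μ_α, c_α)` indexed by the filter `lf`:
`L̄(t) = limsup_α c_α · log ∫ exp(t·x/c_α) dμ_α(x)`. -/
def genLogMGF {ι : Type*} (lf : Filter ι) (μ : ι → Measure ℝ) (c : ι → ℝ) (t : ℝ) : EReal :=
  Filter.limsup
    (fun i => elog (c i) (∫⁻ x : ℝ, ENNReal.ofReal (Real.exp (t * x / c i)) ∂ (μ i))) lf

/-- Legendre–Fenchel transform of an `EReal`-valued function on `ℝ`, evaluated at an
extended real argument: `L*(x) = sup_t (t·x − L(t))`. -/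
def LegendreEE (L : ℝ → EReal) (x : EReal) : EReal := ⨆ t : ℝ, ((t : EReal) * x - L t)

open Classical in
/-- The right derivative of a convex `EReal`-valued function at `t`, with the conventions
`L'_r(t) = +∞` when `L(s) = +∞` for all `s > t` and `L'_r(t) = -∞` when `L(s) = -∞` for
some `s > t`; otherwise it is the infimum of the right difference quotients. -/
def rightDerivE (L : ℝ → EReal) (t : ℝ) : EReal :=
  if ∀ s : ℝ, t < s → L s = ⊤ then ⊤
  else if ∃ s : ℝ, t < s ∧ L s = ⊥ then ⊥
  else ⨅ s ∈ Set.Ioi t, (L s - L t) * (((s - t)⁻¹ : ℝ) : EReal)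

/-- The left derivative of a convex `EReal`-valued function at `t` (supremum of left
difference quotients). -/
def leftDerivE (L : ℝ → EReal) (t : ℝ) : EReal :=
  ⨆ s ∈ Set.Iio t, (L t - L s) * (((t - s)⁻¹ : ℝ) : EReal)

/-- Right limit at `a` of an `EReal`-valued function (as a `limsup`; it coincides with
`lim_{t→a⁺} f(t)` whenever the latter exists, e.g. for monotone or convex `f`). -/
def rightLimE (f : ℝ → EReal) (a : ℝ) : EReal := Filter.limsup f (nhdsWithin a (Set.Ioi a))

/-- Left limit at `a` of an `EReal`-valued function (as a `limsup`; it coincides with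
`lim_{t→a⁻} f(t)` whenever the latter exists). -/
def leftLimE (f : ℝ → EReal) (a : ℝ) : EReal := Filter.limsup f (nhdsWithin a (Set.Iio a))

/-- `L` is affine on the interval `(a, b]`. -/
def AffineOnIoc (L : ℝ → EReal) (a b : ℝ) : Prop :=
  ∃ p q : ℝ, ∀ s ∈ Set.Ioc a b, L s = ((p * s + q : ℝ) : EReal)

/-- `λ̃ = sup {t > λ : L is affine on (λ, t]}` (equal to `λ` if there is no such `t`). -/
def tildeOf (L : ℝ → EReal) (lam : ℝ) : ℝ :=
  sSup (insert lam {t : ℝ | lam < t ∧ AffineOnIoc L lam t})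

/-- Differentiability at `t` of an `EReal`-valued function: `L(t)` is finite and the
difference quotients converge to a (finite) real number. -/
def EDifferentiableAt (L : ℝ → EReal) (t : ℝ) : Prop :=
  (∃ r : ℝ, L t = (r : EReal)) ∧
  ∃ d : ℝ, Filter.Tendsto (fun s => (L s - L t) * (((s - t)⁻¹ : ℝ) : EReal))
    (nhdsWithin t {t}ᶜ) (nhds (d : EReal))

/-- The function `l₀(x) = − lim_{ε→0⁺} limsup_α c_α · log μ_α((x−ε, x+ε))` (the limit over
`ε` exists by monotonicity and equals the infimum). -/
def l0fun {ι : Type*} (lf : Filter ι) (μ : ι → Measure ℝ) (c : ι → ℝ) (x : ℝ) : EReal :=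
  - ⨅ ε ∈ Set.Ioi (0:ℝ),
      Filter.limsup (fun i => elog (c i) (μ i (Set.Ioo (x - ε) (x + ε)))) lf

/-- `L` restricted to `[0,∞)` is proper: `(−∞,+∞]`-valued with at least one finite value. -/
def LbarProper (L : ℝ → EReal) : Prop :=
  (∀ t : ℝ, 0 ≤ t → L t ≠ ⊥) ∧ ∃ t : ℝ, 0 ≤ t ∧ L t ≠ ⊤

/-- `μ([x, y])` for extended-real endpoints `x, y`, with `μ` regarded as a measure on
`[-∞, +∞]`. -/
def muIccE (μ : Measure ℝ) (x y : EReal) : ENNReal :=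
  μ {z : ℝ | x ≤ (z : EReal) ∧ (z : EReal) ≤ y}

/-- `μ((x, y))` for extended-real endpoints `x, y`. -/
def muIooE (μ : Measure ℝ) (x y : EReal) : ENNReal :=
  μ {z : ℝ | x < (z : EReal) ∧ (z : EReal) < y}

open Classical in
/-- The Legendre transform extended to `[-∞,+∞]` by continuity, with the paper's
convention `L̄*(−∞) = −L̄(0⁺)`. -/
def LegendreExt (L : ℝ → EReal) (x : EReal) : EReal :=
  if x = ⊥ then -(rightLimE L 0) else if x = ⊤ then ⊤ else LegendreEE L x

end

/-- A multiple of a logarithm is bounded by `a` iff its argument is bounded by `exp (a / c)`. -/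
lemma elog_le_coe_iff {c : ℝ} (hc : 0 < c) (m : ENNReal) (a : ℝ) :
    elog c m ≤ (a : EReal) ↔ m ≤ ENNReal.ofReal (Real.exp (a / c)) := by
  rw [← ENNReal.log_le_log_iff, ENNReal.log_ofReal_of_pos (Real.exp_pos _), Real.log_exp,
    EReal.coe_div, EReal.le_div_iff_mul_le (EReal.coe_pos.2 hc) (EReal.coe_ne_top c), mul_comm]
  rfl

/-- Convexity of the generalized log-moment generating function, in strict epigraph form. -/
lemma genLogMGF_convex_comb_le {ι : Type*} {lf : Filter ι} {μ : ι → Measure ℝ} {c : ι → ℝ}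
    (hc : ∀ i, 0 < c i) {s t a b p q : ℝ} (ha : genLogMGF lf μ c s < a)
    (hb : genLogMGF lf μ c t < b) (hp : 0 ≤ p) (hq : 0 ≤ q) (hpq : p + q = 1) :
    genLogMGF lf μ c (p * s + q * t) ≤ ((p * a + q * b : ℝ) : EReal) := by
  refine limsup_le_of_le (by isBoundedDefault) ?_
  filter_upwards [eventually_lt_of_limsup_lt ha, eventually_lt_of_limsup_lt hb] with i hs ht
  have hs := (elog_le_coe_iff (hc i) _ _).1 hs.le
  have ht := (elog_le_coe_iff (hc i) _ _).1 ht.le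
  rw [elog_le_coe_iff (hc i)]
  have split (x y : ℝ) : ENNReal.ofReal (Real.exp (p * x + q * y))
      = ENNReal.ofReal (Real.exp x) ^ p * ENNReal.ofReal (Real.exp y) ^ q := by
    rw [ENNReal.ofReal_rpow_of_pos (Real.exp_pos _), ENNReal.ofReal_rpow_of_pos (Real.exp_pos _),
      ← ENNReal.ofReal_mul (by positivity), ← Real.exp_mul, ← Real.exp_mul, ← Real.exp_add]
    ring_nf
  calc ∫⁻ x : ℝ, ENNReal.ofReal (Real.exp ((p * s + q * t) * x / c i)) ∂ (μ i)
      = ∫⁻ x : ℝ, ENNReal.ofReal (Real.exp (s * x / c i)) ^ p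
          * ENNReal.ofReal (Real.exp (t * x / c i)) ^ q ∂ (μ i) := by
        refine lintegral_congr fun x => ?_
        rw [← split]
        ring_nf
    _ ≤ _ := ENNReal.lintegral_mul_norm_pow_le (by fun_prop) (by fun_prop) hp hq hpq
    _ ≤ ENNReal.ofReal (Real.exp (a / c i)) ^ p * ENNReal.ofReal (Real.exp (b / c i)) ^ q := by
        gcongr
    _ = _ := by
        rw [← split]
        ring_nf

lemma genLogMGF_zero {ι : Type*} {lf : Filter ι} [lf.NeBot] {μ : ι → Measure ℝ}
    [∀ i, IsProbabilityMeasure (μ i)] {c : ι → ℝ} : genLogMGF lf μ c 0 = 0 := by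
  simp [genLogMGF, elog]

/-- A convex function that vanishes at `0`, is `< ⊤` at some `T > 0` and does not take the value `⊥`
on `[0, ∞)` never takes the value `⊥`. -/
lemma ne_bot_of_convex_comb_le {L : ℝ → EReal}
    (hL : ∀ ⦃s t a b p q : ℝ⦄, L s < a → L t < b → 0 ≤ p → 0 ≤ q → p + q = 1 →
      L (p * s + q * t) ≤ ((p * a + q * b : ℝ) : EReal))
    (h0 : L 0 = 0) {T : ℝ} (hT : 0 < T) (hLT : L T ≠ ⊤) (hbot : ∀ t, 0 ≤ t → L t ≠ ⊥) (t : ℝ) :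
    L t ≠ ⊥ := by
  intro ht
  have htneg : t < 0 := by
    by_contra h
    exact hbot t (not_lt.1 h) ht
  obtain ⟨b, hb, -⟩ := EReal.lt_iff_exists_real_btwn.1 (lt_top_iff_ne_top.2 hLT)
  have hd : 0 < T - t := by linarith
  have hp : 0 < T / (T - t) := by positivity
  have hq : 0 ≤ -t / (T - t) := div_nonneg (by linarith) hd.le
  have key := hL (s := t) (t := T) (a := (-(-t / (T - t) * b) - 1) / (T / (T - t)))
    (b := b) (p := T / (T - t)) (q := -t / (T - t)) (by rw [ht]; exact EReal.bot_lt_coe _) hb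
    hp.le hq (by field_simp; ring)
  rw [show T / (T - t) * t + -t / (T - t) * T = 0 by ring, h0, mul_div_cancel₀ _ hp.ne'] at key
  have key' : (0 : ℝ) ≤ -(-t / (T - t) * b) - 1 + -t / (T - t) * b := by exact_mod_cast key
  linarith

/-- The real-valued version of an `EReal`-valued convex function is convex on the effective
domain. -/
lemma convexOn_toReal_of_convex_comb_le {L : ℝ → EReal}
    (hL : ∀ ⦃s t a b p q : ℝ⦄, L s < a → L t < b → 0 ≤ p → 0 ≤ q → p + q = 1 →
      L (p * s + q * t) ≤ ((p * a + q * b : ℝ) : EReal))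
    (hbot : ∀ t, L t ≠ ⊥) : ConvexOn ℝ {t | L t ≠ ⊤} (fun t => (L t).toReal) := by
  have hlt {s : ℝ} (hs : L s ≠ ⊤) {ε : ℝ} (hε : 0 < ε) :
      L s < (((L s).toReal + ε : ℝ) : EReal) := by
    conv_lhs => rw [← EReal.coe_toReal hs (hbot s)]
    exact_mod_cast lt_add_of_pos_right _ hε
  refine ⟨fun s hs t ht p q hp hq hpq => ?_, fun s hs t ht p q hp hq hpq => ?_⟩
  · exact ((hL (hlt hs one_pos) (hlt ht one_pos) hp hq hpq).trans_lt (EReal.coe_lt_top _)).ne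
  · refine le_of_forall_pos_le_add fun ε hε => ?_
    have key := EReal.toReal_le_toReal (hL (hlt hs hε) (hlt ht hε) hp hq hpq) (hbot _)
      (EReal.coe_ne_top _)
    rw [EReal.toReal_coe] at key
    simp only [smul_eq_mul]
    refine key.trans (le_of_eq ?_)
    linear_combination ε * hpq

/-- A convex function has a finite right limit at the left end of an interval. -/
lemma ConvexOn.exists_tendsto_nhdsGT {f : ℝ → ℝ} {D : Set ℝ} (hf : ConvexOn ℝ D f) {a b : ℝ}
    (ha : a ∈ D) (hb : b ∈ D) (hab : a < b) : ∃ l ≤ f a, Tendsto f (𝓝[>] a) (𝓝 l) := by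
  have hD : Icc a b ⊆ D := hf.1.ordConnected.out ha hb
  set h : ℝ → ℝ := fun t => (f t - f b) / (t - b) with hh
  have hmono : MonotoneOn h (Ico a b) := fun x hx y hy hxy =>
    hf.secant_mono hb (hD (Ico_subset_Icc_self hx)) (hD (Ico_subset_Icc_self hy)) hx.2.ne
      hy.2.ne hxy
  have hlow : h a ∈ lowerBounds (h '' Ioo a b) := by
    rintro _ ⟨x, hx, rfl⟩
    exact hmono ⟨le_rfl, hab⟩ (Ioo_subset_Ico_self hx) hx.1.le
  have hlim := (hmono.mono Ioo_subset_Ico_self).tendsto_nhdsWithin_Ioo_right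
    (nonempty_Ioo.2 hab) ⟨_, hlow⟩
  have hle : h a ≤ sInf (h '' Ioo a b) := le_csInf ((nonempty_Ioo.2 hab).image h) hlow
  have hid : Tendsto (fun t : ℝ => t - b) (𝓝[>] a) (𝓝 (a - b)) :=
    ((continuous_id.sub continuous_const).tendsto a).mono_left nhdsWithin_le_nhds
  refine ⟨f b + sInf (h '' Ioo a b) * (a - b), ?_, ?_⟩
  · have : h a * (a - b) = f a - f b := div_mul_cancel₀ _ (by linarith)
    nlinarith
  · refine ((hlim.mul hid).const_add (f b)).congr' ?_
    filter_upwards [Ioo_mem_nhdsGT hab] with t ht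
    rw [hh]
    simp only
    rw [div_mul_cancel₀ _ (by linarith [ht.2])]
    ring

/-- At an interior point of the effective domain, the right derivative of a convex function is
finite and is the slope of a supporting line. -/
lemma rightDerivE_spec {L : ℝ → EReal} (hbot : ∀ t, L t ≠ ⊥)
    (hf : ConvexOn ℝ {t | L t ≠ ⊤} (fun t => (L t).toReal)) {r u v : ℝ} (hr : L r ≠ ⊤)
    (hv : L v ≠ ⊤) (hru : r < u) (huv : u < v) :
    ∃ m : ℝ, rightDerivE L u = m ∧
      ∀ t, L t ≠ ⊤ → (L u).toReal + m * (t - u) ≤ (L t).toReal := by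
  have hu : L u ≠ ⊤ := hf.1.ordConnected.out hr hv ⟨hru.le, huv.le⟩
  have hcoe {t : ℝ} (ht : L t ≠ ⊤) : L t = ((L t).toReal : EReal) :=
    (EReal.coe_toReal ht (hbot t)).symm
  have hquot {t : ℝ} (ht : L t ≠ ⊤) : (L t - L u) * (((t - u)⁻¹ : ℝ) : EReal)
      = ((((L t).toReal - (L u).toReal) / (t - u) : ℝ) : EReal) := by
    rw [hcoe ht, hcoe hu, EReal.toReal_coe, EReal.toReal_coe, ← EReal.coe_sub, ← EReal.coe_mul,
      div_eq_mul_inv]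
  have hdef : rightDerivE L u = ⨅ s ∈ Ioi u, (L s - L u) * (((s - u)⁻¹ : ℝ) : EReal) := by
    rw [rightDerivE, if_neg fun h => hv (h v huv), if_neg fun ⟨s, _, hs⟩ => hbot s hs]
  have hupper {t : ℝ} (ht : L t ≠ ⊤) (hut : u < t) :
      rightDerivE L u ≤ ((((L t).toReal - (L u).toReal) / (t - u) : ℝ) : EReal) := by
    rw [hdef, ← hquot ht]
    exact iInf₂_le t hut
  have hlower {s : ℝ} (hs : L s ≠ ⊤) (hsu : s < u) :
      ((((L u).toReal - (L s).toReal) / (u - s) : ℝ) : EReal) ≤ rightDerivE L u := by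
    rw [hdef]
    refine le_iInf₂ fun t ht => ?_
    by_cases htop : L t = ⊤
    · rw [htop, hcoe hu, EReal.top_sub_coe,
        EReal.top_mul_coe_of_pos (inv_pos.2 (sub_pos.2 ht))]
      exact le_top
    · rw [hquot htop]
      exact EReal.coe_le_coe_iff.2 (hf.slope_mono_adjacent hs htop hsu ht)
  have hm : ((rightDerivE L u).toReal : EReal) = rightDerivE L u :=
    EReal.coe_toReal ((hupper hv huv).trans_lt (EReal.coe_lt_top _)).ne
      ((EReal.bot_lt_coe _).trans_le (hlower hr hru)).ne'
  refine ⟨_, hm.symm, fun t ht => ?_⟩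
  rcases lt_trichotomy t u with h | rfl | h
  · have := hlower ht h
    rw [← hm, EReal.coe_le_coe_iff, div_le_iff₀ (sub_pos.2 h)] at this
    linarith
  · simp
  · have := hupper ht h
    rw [← hm, EReal.coe_le_coe_iff, le_div_iff₀ (sub_pos.2 h)] at this
    linarith

/-- If `f` has a finite right limit at `0` and a supporting line of slope `m u` at every
`u ∈ (0, T)`, then `u * m u → 0` as `u → 0⁺`. -/
lemma tendsto_mul_slope_nhdsGT_zero {f m : ℝ → ℝ} {T l : ℝ} (hT : 0 < T)
    (hlim : Tendsto f (𝓝[>] 0) (𝓝 l))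
    (hm : ∀ u ∈ Ioo 0 T, ∀ t ∈ Ioo 0 T, f u + m u * (t - u) ≤ f t) :
    Tendsto (fun u => u * m u) (𝓝[>] 0) (𝓝 0) := by
  have hscale {k : ℝ} (hk : 0 < k) : Tendsto (fun u => f (k * u)) (𝓝[>] 0) (𝓝 l) := by
    refine hlim.comp (tendsto_nhdsWithin_iff.2 ⟨?_, ?_⟩)
    · simpa using ((continuous_const_mul k).tendsto 0).mono_left nhdsWithin_le_nhds
    · filter_upwards [self_mem_nhdsWithin] with u hu using mul_pos hk hu
  have hup : Tendsto (fun u => f (2 * u) - f u) (𝓝[>] 0) (𝓝 0) := by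
    simpa using (hscale two_pos).sub hlim
  have hlow : Tendsto (fun u => 2 * (f u - f (1 / 2 * u))) (𝓝[>] 0) (𝓝 0) := by
    simpa using (hlim.sub (hscale (k := 1 / 2) (by norm_num))).const_mul 2
  refine tendsto_of_tendsto_of_tendsto_of_le_of_le' hlow hup ?_ ?_
  all_goals
    filter_upwards [Ioo_mem_nhdsGT (half_pos hT)] with u hu
    have hu1 := hu.1
    have hu2 := hu.2
  · linarith [hm u ⟨hu1, by linarith⟩ (1 / 2 * u) ⟨by linarith, by linarith⟩]
  · linarith [hm u ⟨hu1, by linarith⟩ (2 * u) ⟨by linarith, by linarith⟩]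

/-- An affine minorant of slope `m` bounds the Legendre transform at `m`. -/
lemma LegendreEE_coe_le {L : ℝ → EReal} (hbot : ∀ t, L t ≠ ⊥) {m y : ℝ}
    (h : ∀ t, L t ≠ ⊤ → y + m * t ≤ (L t).toReal) : LegendreEE L m ≤ ((-y : ℝ) : EReal) := by
  refine iSup_le fun t => ?_
  by_cases ht : L t = ⊤
  · rw [ht, EReal.sub_top]
    exact bot_le
  · rw [← EReal.coe_toReal ht (hbot t), ← EReal.coe_mul, ← EReal.coe_sub, EReal.coe_le_coe_iff]
    linarith [h t ht]

theorem statement15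
    {ι : Type*} (lf : Filter ι) [lf.NeBot]
    (μ : ι → Measure ℝ) [∀ i, IsProbabilityMeasure (μ i)]
    (c : ι → ℝ) (hc : ∀ i, 0 < c i) (hc0 : Filter.Tendsto c lf (nhds (0 : ℝ)))
    (L : ℝ → EReal) (hL : L = genLogMGF lf μ c)
    (hp : LbarProper L) (hfin : ∃ t : ℝ, 0 < t ∧ L t ≠ ⊤)
    (tseq : ℕ → ℝ) (htpos : ∀ i, 0 < tseq i)
    (htlim : Filter.Tendsto tseq Filter.atTop (nhds (0 : ℝ))) :
    Filter.Tendsto (fun i => LegendreEE L (rightDerivE L (tseq i))) Filter.atTop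
      (nhds (- rightLimE L 0)) ∧
    (∃ r : ℝ, 0 ≤ r ∧ rightLimE L 0 = ((-r : ℝ) : EReal)) ∧
    (rightLimE (rightDerivE L) 0 ≠ ⊥ →
      Filter.Tendsto (fun i => LegendreEE L (rightDerivE L (tseq i))) Filter.atTop
        (nhds (LegendreEE L (rightLimE (rightDerivE L) 0))) ∧
      LegendreEE L (rightLimE (rightDerivE L) 0) =
        ⨆ t ∈ Set.Ioi (0:ℝ), ((t : EReal) * rightLimE (rightDerivE L) 0 - L t)) := by
  have hconv : ∀ ⦃s t a b p q : ℝ⦄, L s < a → L t < b → 0 ≤ p → 0 ≤ q → p + q = 1 →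
      L (p * s + q * t) ≤ ((p * a + q * b : ℝ) : EReal) := by
    subst hL
    exact fun s t a b p q => genLogMGF_convex_comb_le hc
  have h0 : L 0 = 0 := hL ▸ genLogMGF_zero
  obtain ⟨T, hT, hLT⟩ := hfin
  have hbot := ne_bot_of_convex_comb_le hconv h0 hT hLT hp.1
  have hf := convexOn_toReal_of_convex_comb_le hconv hbot
  have hL0 : L 0 ≠ ⊤ := by simp [h0]
  have hdom {t : ℝ} (ht : t ∈ Ioo 0 T) : L t ≠ ⊤ :=
    hf.1.ordConnected.out hL0 hLT (Ioo_subset_Icc_self ht)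
  obtain ⟨l, hl0, hl⟩ := hf.exists_tendsto_nhdsGT hL0 hLT hT
  replace hl0 : l ≤ 0 := by simpa [h0] using hl0
  have hIoo : ∀ᶠ u in 𝓝[>] (0 : ℝ), u ∈ Ioo 0 T := Ioo_mem_nhdsGT hT
  have hlimL : rightLimE L 0 = (l : EReal) := by
    refine Tendsto.limsup_eq (Tendsto.congr' ?_ ((continuous_coe_real_ereal.tendsto l).comp hl))
    filter_upwards [hIoo] with u hu using EReal.coe_toReal (hdom hu) (hbot u)
  have hspec : ∀ u ∈ Ioo 0 T, ∃ m : ℝ, rightDerivE L u = m ∧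
      ∀ t, L t ≠ ⊤ → (L u).toReal + m * (t - u) ≤ (L t).toReal :=
    fun u hu => rightDerivE_spec hbot hf hL0 hLT hu.1 hu.2
  choose! m hm hsupp using hspec
  have htm : Tendsto (fun u => u * m u) (𝓝[>] 0) (𝓝 0) :=
    tendsto_mul_slope_nhdsGT_zero hT hl fun u hu t ht => hsupp u hu t (hdom ht)
  have hleg {u : ℝ} (hu : u ∈ Ioo 0 T) :
      LegendreEE L (rightDerivE L u) = ((u * m u - (L u).toReal : ℝ) : EReal) := by
    rw [hm u hu]
    refine le_antisymm ?_ (le_iSup_of_le u ?_)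
    · rw [← neg_sub]
      refine LegendreEE_coe_le hbot fun t ht => ?_
      linarith [hsupp u hu t ht]
    · rw [EReal.coe_sub, EReal.coe_mul, EReal.coe_toReal (hdom hu) (hbot u)]
  have hmain : Tendsto (fun u => LegendreEE L (rightDerivE L u)) (𝓝[>] 0)
      (𝓝 ((-l : ℝ) : EReal)) := by
    have hreal : Tendsto (fun u => u * m u - (L u).toReal) (𝓝[>] 0) (𝓝 (-l)) := by
      simpa using htm.sub hl
    refine Tendsto.congr' ?_ ((continuous_coe_real_ereal.tendsto _).comp hreal)
    filter_upwards [hIoo] with u hu using (hleg hu).symm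
  have hseq : Tendsto tseq atTop (𝓝[>] 0) :=
    tendsto_nhdsWithin_iff.2 ⟨htlim, Eventually.of_forall htpos⟩
  refine ⟨?_, ⟨-l, by linarith, by rw [hlimL, neg_neg]⟩, fun hD => ?_⟩
  · rw [hlimL, ← EReal.coe_neg]
    exact hmain.comp hseq
  have hmono : MonotoneOn m (Ioo 0 T) := by
    intro u hu v hv huv
    rcases huv.eq_or_lt with rfl | huv
    · rfl
    · have h1 := hsupp u hu v (hdom hv)
      have h2 := hsupp v hv u (hdom hu)
      nlinarith
  have hDlim : Tendsto (rightDerivE L) (𝓝[>] 0) (𝓝 (rightLimE (rightDerivE L) 0)) := by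
    have hmonoE : MonotoneOn (rightDerivE L) (Ioo 0 T) := fun u hu v hv huv => by
      rw [hm u hu, hm v hv]
      exact EReal.coe_le_coe_iff.2 (hmono hu hv huv)
    have := hmonoE.tendsto_nhdsWithin_Ioo_right (nonempty_Ioo.2 hT) (OrderBot.bddBelow _)
    rwa [rightLimE, this.limsup_eq]
  have hhalf : T / 2 ∈ Ioo 0 T := ⟨by linarith, by linarith⟩
  have hDtop : rightLimE (rightDerivE L) 0 ≠ ⊤ := by
    refine ne_top_of_le_ne_top (EReal.coe_ne_top (m (T / 2))) (le_of_tendsto hDlim ?_)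
    filter_upwards [Ioo_mem_nhdsGT hhalf.1] with u hu
    have hu' : u ∈ Ioo 0 T := ⟨hu.1, hu.2.trans hhalf.2⟩
    rw [hm u hu']
    exact EReal.coe_le_coe_iff.2 (hmono hu' hhalf hu.2.le)
  obtain ⟨d, hd⟩ : ∃ d : ℝ, rightLimE (rightDerivE L) 0 = d :=
    ⟨_, (EReal.coe_toReal hDtop hD).symm⟩
  rw [hd] at hDlim ⊢
  have hmlim : Tendsto m (𝓝[>] 0) (𝓝 d) := by
    rw [← EReal.tendsto_coe]
    refine hDlim.congr' ?_
    filter_upwards [hIoo] with u hu using hm u hu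
  have hle : LegendreEE L d ≤ ((-l : ℝ) : EReal) := by
    refine LegendreEE_coe_le hbot fun t ht => ?_
    have hlim : Tendsto (fun u => (L u).toReal + m u * (t - u)) (𝓝[>] 0)
        (𝓝 (l + d * (t - 0))) :=
      hl.add (hmlim.mul (((continuous_const.sub continuous_id).tendsto 0).mono_left
        nhdsWithin_le_nhds))
    rw [sub_zero] at hlim
    refine le_of_tendsto hlim ?_
    filter_upwards [hIoo] with u hu using hsupp u hu t ht
  have hge : ((-l : ℝ) : EReal) ≤ ⨆ t ∈ Ioi (0 : ℝ), ((t : EReal) * d - L t) := by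
    have hlim : Tendsto (fun u => u * d - (L u).toReal) (𝓝[>] 0) (𝓝 (0 * d - l)) :=
      (((continuous_mul_const d).tendsto 0).mono_left nhdsWithin_le_nhds).sub hl
    rw [zero_mul, zero_sub] at hlim
    refine le_of_tendsto ((continuous_coe_real_ereal.tendsto _).comp hlim) ?_
    filter_upwards [hIoo] with u hu
    refine le_iSup₂_of_le u hu.1 ?_
    rw [Function.comp_apply, EReal.coe_sub, EReal.coe_mul, EReal.coe_toReal (hdom hu) (hbot u)]
  have hsub : (⨆ t ∈ Ioi (0 : ℝ), ((t : EReal) * d - L t)) ≤ LegendreEE L d :=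
    iSup₂_le fun t _ => le_iSup (fun t : ℝ => (t : EReal) * d - L t) t
  refine ⟨?_, le_antisymm (hle.trans hge) hsub⟩
  rw [le_antisymm hle (hge.trans hsub)]
  exact hmain.comp hseq
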